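/- arXiv:1801.03388 — 2 statements merged into one kernel-verified Lean document; each statement's English description precedes it below -/
import Mathlib

section
/- The midpoint rule is exact for C¹ quintic data in the following sense: for every polynomial p of degree at most 5 with p(0) = p(1) = 0 and p'(0) = p'(1) = 0, ∫₀¹ p(x) dx = p(1/2) · 1 fails in general, but the two-point rule with nodes 0 and 1/2 and weights 7/15 and 8/15 satisfies ∫₀¹ p(x) dx = (8/15)·p(1/2) for all such p. -/
/-- The C¹ quintic rule C1xD5: on quintics vanishing to first order at both
endpoints, the pure midpoint rule with weight 1 fails in general, but the rule
with nodes 0, 1/2 and weights 7/15, 8/15 is exact (contributing (8/15)·p(1/2)). -/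
theorem c1_degree5_rule :
    (¬ ∀ p : Polynomial ℝ, p.natDegree ≤ 5 →
        p.eval 0 = 0 → p.eval 1 = 0 →
        p.derivative.eval 0 = 0 → p.derivative.eval 1 = 0 →
        ∫ x in (0:ℝ)..1, p.eval x = p.eval (1/2) * 1) ∧
    (∀ p : Polynomial ℝ, p.natDegree ≤ 5 →
        p.eval 0 = 0 → p.eval 1 = 0 →
        p.derivative.eval 0 = 0 → p.derivative.eval 1 = 0 →
        ∫ x in (0:ℝ)..1, p.eval x = (8/15) * p.eval (1/2)) := by
  have key : ∀ p : Polynomial ℝ, p.natDegree ≤ 5 →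
        p.eval 0 = 0 → p.eval 1 = 0 →
        p.derivative.eval 0 = 0 → p.derivative.eval 1 = 0 →
        ∫ x in (0:ℝ)..1, p.eval x = (8/15) * p.eval (1/2) := by
    intro p hp h0 h1 d0 d1
    have he : ∀ x : ℝ, p.eval x = ∑ i ∈ Finset.range 6, p.coeff i * x ^ i := fun x =>
      Polynomial.eval_eq_sum_range' (by omega) x
    have hd : ∀ x : ℝ, p.derivative.eval x
        = ∑ i ∈ Finset.range 5, p.derivative.coeff i * x ^ i := fun x =>
      Polynomial.eval_eq_sum_range' (by
        have := Polynomial.natDegree_derivative_le p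
        omega) x
    have hI : ∫ x in (0:ℝ)..1, p.eval x
        = ∑ i ∈ Finset.range 6, p.coeff i * (1 / ((i:ℝ) + 1)) := by
      simp_rw [he]
      rw [intervalIntegral.integral_finsetSum]
      · refine Finset.sum_congr rfl fun i _ => ?_
        rw [intervalIntegral.integral_const_mul, integral_pow]
        simp
      · intro i _
        exact (by fun_prop : Continuous fun x : ℝ => p.coeff i * x ^ i).intervalIntegrable _ _
    rw [hI, he]
    rw [he] at h0 h1
    rw [hd] at d0 d1
    simp only [Finset.sum_range_succ, Finset.sum_range_zero, Polynomial.coeff_derivative]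
      at h0 h1 d0 d1 ⊢
    norm_num at h0 h1 d0 d1 ⊢
    linarith
  refine ⟨fun h => ?_, key⟩
  have hdeg : (Polynomial.X ^ 2 * (1 - Polynomial.X) ^ 2 : Polynomial ℝ).natDegree ≤ 5 := by
    compute_degree
    all_goals norm_num
  have a := h (Polynomial.X ^ 2 * (1 - Polynomial.X) ^ 2) hdeg (by simp) (by simp)
    (by simp) (by simp [Polynomial.derivative_pow])
  have b := key (Polynomial.X ^ 2 * (1 - Polynomial.X) ^ 2) hdeg (by simp) (by simp)
    (by simp) (by simp [Polynomial.derivative_pow])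
  rw [a] at b
  norm_num at b
end

section
/- For every n ≥ 2, the polynomial Rₙ(x) = n²·Cₙ^{(3/2)}(x) − (n+1)²·C_{n−2}^{(3/2)}(x) has exactly n simple real roots, all lying in the open interval (−1, 1). -/
/-- Gegenbauer polynomials `C_n^{(α)}` defined by the standard three-term
recurrence: `C_0 = 1`, `C_1 = 2αx`,
`(n+2) C_{n+2} = 2(n+1+α) x C_{n+1} − (n+2α) C_n`. -/
noncomputable def gegenbauer (α : ℝ) : ℕ → Polynomial ℝ
  | 0 => 1
  | 1 => Polynomial.C (2 * α) * Polynomial.X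
  | (n + 2) =>
      Polynomial.C (2 * ((n : ℝ) + 1 + α) / ((n : ℝ) + 2)) * Polynomial.X *
          gegenbauer α (n + 1) -
        Polynomial.C (((n : ℝ) + 2 * α) / ((n : ℝ) + 2)) * gegenbauer α n


open Polynomial in
lemma aux_roots (f : ℝ[X]) (N : ℕ) (hf : f ≠ 0) (hd : f.natDegree ≤ N) (z : ℕ → ℝ)
    (hz : ∀ i j, i < j → j < N → z i < z j) (hr : ∀ i < N, f.eval (z i) = 0) :
    ((Finset.range N).image z).card = N ∧ f.roots = ((Finset.range N).image z).val := by
  have hc : ((Finset.range N).image z).card = N := by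
    rw [Finset.card_image_of_injOn, Finset.card_range]
    intro i hi j hj hij
    simp only [Finset.coe_range, Set.mem_Iio] at hi hj
    rcases lt_trichotomy i j with h | h | h
    · exact absurd hij (hz i j h hj).ne
    · exact h
    · exact absurd hij (hz j i h hi).ne'
  refine ⟨hc, ?_⟩
  symm
  apply Multiset.eq_of_le_of_card_le
  · rw [Finset.val_le_iff_val_subset]
    intro a ha
    rw [Finset.mem_val, Finset.mem_image] at ha
    obtain ⟨i, hi, rfl⟩ := ha
    exact (mem_roots hf).2 (hr i (Finset.mem_range.1 hi))
  · rw [Finset.card_val, hc]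
    exact (card_roots' f).trans hd

lemma aux_prod (z : ℕ → ℝ) (x : ℝ) (k N : ℕ) (hk : k ≤ N) (h1 : ∀ j < k, z j < x)
    (h2 : ∀ j, k ≤ j → j < N → x < z j) :
    0 < (-1 : ℝ) ^ (N + k) * ∏ j ∈ Finset.range N, (x - z j) := by
  induction N, hk using Nat.le_induction with
  | base =>
    rw [Even.neg_one_pow ⟨k, rfl⟩, one_mul]
    exact Finset.prod_pos fun j hj => sub_pos.2 (h1 j (Finset.mem_range.1 hj))
  | succ n hn ih =>
    have := ih (fun j hj hj' => h2 j hj (by omega))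
    have h3 := h2 n hn (by omega)
    rw [Finset.prod_range_succ, show n + 1 + k = n + k + 1 by ring, pow_succ]
    nlinarith [mul_pos this (sub_pos.2 h3)]

open Polynomial in
lemma aux_sign (f : ℝ[X]) (N : ℕ) (hd : f.natDegree ≤ N) (z : ℕ → ℝ)
    (hz : ∀ i j, i < j → j < N → z i < z j) (hr : ∀ i < N, f.eval (z i) = 0)
    (h1 : 0 < f.eval 1) (hz1 : ∀ i < N, z i < 1) (x : ℝ) (k : ℕ) (hk : k ≤ N)
    (hx1 : ∀ j < k, z j < x) (hx2 : ∀ j, k ≤ j → j < N → x < z j) :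
    0 < (-1 : ℝ) ^ (N + k) * f.eval x := by
  have hf : f ≠ 0 := by rintro rfl; simp at h1
  obtain ⟨hc, hroots⟩ := aux_roots f N hf hd z hz hr
  have hinj : Set.InjOn z (Finset.range N : Set ℕ) := by
    rw [← Finset.card_image_iff, hc, Finset.card_range]
  have hcard : f.roots.card = f.natDegree := by
    apply le_antisymm (card_roots' f)
    rw [hroots, Finset.card_val, hc]; exact hd
  have hfac := C_leadingCoeff_mul_prod_multiset_X_sub_C hcard
  have hev : ∀ t, f.eval t = f.leadingCoeff * ∏ j ∈ Finset.range N, (t - z j) := by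
    intro t
    have : (f.roots.map fun a => X - C a).prod = ∏ j ∈ Finset.range N, (X - C (z j)) := by
      rw [hroots]
      exact Finset.prod_image (f := fun a => (X - C a : ℝ[X])) hinj
    rw [this] at hfac
    conv_lhs => rw [← hfac]
    simp [eval_prod]
  have hp1 : 0 < ∏ j ∈ Finset.range N, (1 - z j) :=
    Finset.prod_pos fun j hj => sub_pos.2 (hz1 j (Finset.mem_range.1 hj))
  have ha : 0 < f.leadingCoeff := by
    rw [hev] at h1
    exact pos_of_mul_pos_left h1 hp1.le
  rw [hev]
  have := mul_pos ha (aux_prod z x k N hk hx1 hx2)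
  linarith

open Polynomial in
lemma aux_ivt (f : ℝ[X]) (N : ℕ) (y : ℕ → ℝ) (hy : ∀ i < N, y i < y (i + 1))
    (hs : ∀ i ≤ N, 0 < (-1 : ℝ) ^ (N + i) * f.eval (y i)) :
    ∃ w : ℕ → ℝ, ∀ i < N, y i < w i ∧ w i < y (i + 1) ∧ f.eval (w i) = 0 := by
  have : ∀ i, ∃ w, i < N → y i < w ∧ w < y (i + 1) ∧ f.eval w = 0 := by
    intro i
    by_cases hi : i < N
    · have h1 := hs i hi.le
      have h2 := hs (i + 1) hi
      rw [← add_assoc, pow_succ] at h2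
      have hcont : ContinuousOn (fun t => (-1 : ℝ) ^ (N + i) * f.eval t)
          (Set.Icc (y i) (y (i + 1))) := by fun_prop
      obtain ⟨w, hw, hw0⟩ := intermediate_value_Ioo' (hy i hi).le hcont
        (show (0 : ℝ) ∈ _ from ⟨by linarith, h1⟩)
      refine ⟨w, fun _ => ⟨hw.1, hw.2, ?_⟩⟩
      simpa using hw0
    · exact ⟨0, fun h => absurd h hi⟩
  choose w hw using this
  exact ⟨w, hw⟩

lemma geg_rec (n : ℕ) (x : ℝ) : ((n : ℝ) + 2) * (gegenbauer (3/2) (n + 2)).eval x =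
    (2 * n + 5) * x * (gegenbauer (3/2) (n + 1)).eval x
      - (n + 3) * (gegenbauer (3/2) n).eval x := by
  have : (n : ℝ) + 2 ≠ 0 := by positivity
  rw [gegenbauer]
  simp only [Polynomial.eval_sub, Polynomial.eval_mul, Polynomial.eval_C, Polynomial.eval_X]
  field_simp
  ring

lemma geg_one (n : ℕ) : (gegenbauer (3/2) n).eval 1 = ((n : ℝ) + 1) * (n + 2) / 2 ∧
    (gegenbauer (3/2) (n + 1)).eval 1 = ((n : ℝ) + 2) * (n + 3) / 2 := by
  induction n with
  | zero => constructor <;> simp [gegenbauer] <;> norm_num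
  | succ n ih =>
    refine ⟨by rw [ih.2]; push_cast; ring, ?_⟩
    have h := geg_rec n 1
    rw [ih.1, ih.2] at h
    have : (n : ℝ) + 2 ≠ 0 := by positivity
    apply mul_left_cancel₀ this
    push_cast
    linear_combination h

lemma geg_neg_one (n : ℕ) :
    (gegenbauer (3/2) n).eval (-1) = (-1) ^ n * (((n : ℝ) + 1) * (n + 2) / 2) ∧
    (gegenbauer (3/2) (n + 1)).eval (-1) = (-1) ^ (n + 1) * (((n : ℝ) + 2) * (n + 3) / 2) := by
  induction n with
  | zero => constructor <;> simp [gegenbauer] <;> norm_num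
  | succ n ih =>
    refine ⟨by rw [ih.2]; push_cast; ring, ?_⟩
    have h := geg_rec n (-1)
    rw [ih.1, ih.2] at h
    have : (n : ℝ) + 2 ≠ 0 := by positivity
    apply mul_left_cancel₀ this
    push_cast
    linear_combination h

open Polynomial in
lemma geg_deg (n : ℕ) : (gegenbauer (3/2) n).natDegree ≤ n ∧
    (gegenbauer (3/2) (n + 1)).natDegree ≤ n + 1 := by
  induction n with
  | zero =>
    constructor
    · simp [gegenbauer]
    · rw [gegenbauer]; exact natDegree_C_mul_le _ _ |>.trans natDegree_X_le
  | succ n ih =>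
    refine ⟨ih.2, ?_⟩
    rw [gegenbauer]
    refine (natDegree_sub_le _ _).trans (max_le ?_ ?_)
    · rw [mul_assoc]
      refine (natDegree_C_mul_le _ _).trans (natDegree_mul_le.trans ?_)
      have := natDegree_X_le (R := ℝ)
      omega
    · refine (natDegree_C_mul_le _ _).trans ?_
      omega

def Good (m : ℕ) (z : ℕ → ℝ) : Prop :=
  (∀ i j, i < j → j < m + 1 → z i < z j) ∧
  (∀ i < m + 1, -1 < z i ∧ z i < 1) ∧
  (∀ i < m + 1, (gegenbauer (3/2) (m + 1)).eval (z i) = 0) ∧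
  (∀ i < m + 1, 0 < (-1 : ℝ) ^ (m + i) * (gegenbauer (3/2) m).eval (z i))

open Polynomial in
lemma aux_step (m : ℕ) (z : ℕ → ℝ) (h : Good m z) (f : ℝ[X])
    (hf1 : 0 < f.eval 1) (hfm : 0 < (-1 : ℝ) ^ m * f.eval (-1))
    (c : ℝ) (hc : 0 < c)
    (hfz : ∀ i < m + 1, f.eval (z i) = - c * (gegenbauer (3/2) m).eval (z i)) :
    ∃ w : ℕ → ℝ, (∀ i j, i < j → j < m + 2 → w i < w j) ∧
      (∀ i < m + 2, -1 < w i ∧ w i < 1) ∧ (∀ i < m + 2, f.eval (w i) = 0) ∧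
      (∀ i < m + 2, 0 < (-1 : ℝ) ^ (m + 1 + i) * (gegenbauer (3/2) (m + 1)).eval (w i)) := by
  obtain ⟨h1, h2, h3, h4⟩ := h
  obtain ⟨y, hy⟩ : ∃ y : ℕ → ℝ, y = fun i => if i = 0 then -1 else
    if i ≤ m + 1 then z (i - 1) else 1 := ⟨_, rfl⟩
  have y0 : y 0 = -1 := by simp [hy]
  have yz : ∀ i < m + 1, y (i + 1) = z i := by
    intro i hi
    simp [hy]; omega
  have yl : y (m + 2) = 1 := by simp [hy]
  have hmono : ∀ i < m + 2, y i < y (i + 1) := by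
    intro i hi
    rcases i with _ | i
    · rw [y0, yz 0 (by omega)]; exact (h2 0 (by omega)).1
    · rw [yz i (by omega)]
      rcases Nat.lt_or_ge (i + 1) (m + 1) with h | h
      · rw [yz _ h]; exact h1 _ _ (by omega) h
      · obtain rfl : i = m := by omega
        rw [yl]; exact (h2 i (by omega)).2
  have hle : ∀ i j, i ≤ j → j ≤ m + 2 → y i ≤ y j := by
    intro i j hij
    induction j, hij using Nat.le_induction with
    | base => intro _; exact le_rfl
    | succ j hj ih =>
      intro hh
      exact (ih (by omega)).trans (hmono j (by omega)).le
  have hs : ∀ i ≤ m + 2, 0 < (-1 : ℝ) ^ (m + 2 + i) * f.eval (y i) := by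
    intro i hi
    rcases i with _ | i
    · rw [y0, add_zero, pow_add]; simpa using hfm
    · rcases Nat.lt_or_ge i (m + 1) with h | h
      · rw [yz i h, hfz i h, show m + 2 + (i + 1) = (m + i) + 3 by ring, pow_add]
        have := mul_pos hc (h4 i h)
        linarith
      · obtain rfl : i = m + 1 := by omega
        rw [yl, Even.neg_one_pow ⟨m + 2, rfl⟩, one_mul]; exact hf1
  obtain ⟨w, hw⟩ := aux_ivt f (m + 2) y hmono hs
  refine ⟨w, ?_, ?_, fun i hi => (hw i hi).2.2, ?_⟩
  · intro i j hij hj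
    exact (hw i (by omega)).2.1.trans_le ((hle (i + 1) j hij hj.le).trans (hw j hj).1.le)
  · intro i hi
    constructor
    · rw [← y0]; exact (hle 0 i (by omega) hi.le).trans_lt (hw i hi).1
    · rw [← yl]; exact (hw i hi).2.1.trans_le (hle (i + 1) _ (by omega) le_rfl)
  · intro i hi
    refine aux_sign _ (m + 1) (geg_deg m).2 z h1 h3 ?_ (fun i hi => (h2 i hi).2) (w i) i
      (by omega) ?_ ?_
    · rw [(geg_one m).2]; positivity
    · intro j hj
      rw [← yz j (by omega)]
      exact (hle (j + 1) i hj hi.le).trans_lt (hw i hi).1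
    · intro j hj hj'
      rw [← yz j hj']
      exact (hw i hi).2.1.trans_le (hle (i + 1) (j + 1) (by omega) (by omega))

lemma good_exists (m : ℕ) : ∃ z, Good m z := by
  induction m with
  | zero =>
    refine ⟨fun _ => 0, ?_, ?_, ?_, ?_⟩
    · intro i j h1 h2; omega
    · intro i _; norm_num
    · intro i _; simp [gegenbauer]
    · intro i hi
      obtain rfl : i = 0 := by omega
      simp [gegenbauer]
  | succ m ih =>
    obtain ⟨z, hz⟩ := ih
    have hp : (0 : ℝ) < (m : ℝ) + 2 := by positivity
    refine aux_step m z hz (gegenbauer (3/2) (m + 2)) ?_ ?_ (((m : ℝ) + 3) / (m + 2))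
      (by positivity) ?_
    · rw [(geg_one (m + 1)).2]; positivity
    · rw [(geg_neg_one (m + 1)).2, ← mul_assoc, ← pow_add,
        Even.neg_one_pow ⟨m + 1, by ring⟩, one_mul]
      positivity
    · intro i hi
      have h := geg_rec m (z i)
      rw [hz.2.2.1 i hi] at h
      field_simp
      linarith

/-- For n ≥ 2, Rₙ = n²·Cₙ^{(3/2)} − (n+1)²·C_{n−2}^{(3/2)} has exactly n simple
real roots, all in (−1, 1). -/
theorem c0_odd_nodes_real_simple (n : ℕ) (hn : 2 ≤ n) :
    ∃ s : Finset ℝ, s.card = n ∧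
      (∀ x ∈ s, x ∈ Set.Ioo (-1 : ℝ) 1 ∧
        ((n : ℝ) ^ 2 • gegenbauer (3/2) n -
          ((n : ℝ) + 1) ^ 2 • gegenbauer (3/2) (n - 2)).rootMultiplicity x = 1) ∧
      (∀ x : ℝ, ((n : ℝ) ^ 2 • gegenbauer (3/2) n -
          ((n : ℝ) + 1) ^ 2 • gegenbauer (3/2) (n - 2)).IsRoot x → x ∈ s) := by
  obtain ⟨m, rfl⟩ : ∃ m, n = m + 2 := ⟨n - 2, by omega⟩
  rw [Nat.add_sub_cancel]
  obtain ⟨z, hz⟩ := good_exists m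
  generalize hR : (((m + 2 : ℕ) : ℝ) ^ 2 • gegenbauer (3/2) (m + 2) -
          (((m + 2 : ℕ) : ℝ) + 1) ^ 2 • gegenbauer (3/2) m) = R
  have hev : ∀ x, R.eval x = ((m : ℝ) + 2) ^ 2 * (gegenbauer (3/2) (m + 2)).eval x -
      ((m : ℝ) + 3) ^ 2 * (gegenbauer (3/2) m).eval x := by
    intro x
    rw [← hR]
    simp only [Polynomial.eval_sub, Polynomial.eval_smul, smul_eq_mul]
    push_cast
    ring
  have hdeg : R.natDegree ≤ m + 2 := by
    rw [← hR]
    refine (Polynomial.natDegree_sub_le _ _).trans (max_le ?_ ?_)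
    · exact (Polynomial.natDegree_smul_le _ _).trans (geg_deg (m + 2)).1
    · exact (Polynomial.natDegree_smul_le _ _).trans ((geg_deg m).1.trans (by omega))
  have h1 : 0 < R.eval 1 := by
    rw [hev, (geg_one (m + 2)).1, (geg_one m).1]
    push_cast
    have : (0 : ℝ) < ((m : ℝ) + 2) * (m + 3) * (2 * m + 5) / 2 := by positivity
    linarith
  have hm1 : 0 < (-1 : ℝ) ^ m * R.eval (-1) := by
    rw [hev, (geg_neg_one (m + 2)).1, (geg_neg_one m).1]
    push_cast
    have : (0 : ℝ) < ((m : ℝ) + 2) * (m + 3) * (2 * m + 5) / 2 := by positivity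
    have e : (-1 : ℝ) ^ m * (-1) ^ m = 1 := by
      rw [← pow_add]; exact Even.neg_one_pow ⟨m, rfl⟩
    rw [pow_add]
    convert this using 1
    linear_combination (((m : ℝ) + 2) * (m + 3) * (2 * m + 5) / 2) * e
  obtain ⟨w, hw1, hw2, hw3, -⟩ := aux_step m z hz R h1 hm1
    (((m : ℝ) + 3) * (2 * m + 5)) (by positivity) (by
      intro i hi
      have h := geg_rec m (z i)
      rw [hz.2.2.1 i hi] at h
      rw [hev]
      linear_combination ((m : ℝ) + 2) * h)
  have hR0 : R ≠ 0 := by rintro rfl; simp at h1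
  obtain ⟨hc, hroots⟩ := aux_roots R (m + 2) hR0 hdeg w hw1 hw3
  refine ⟨(Finset.range (m + 2)).image w, hc, ?_, ?_⟩
  · intro x hx
    constructor
    · obtain ⟨i, hi, rfl⟩ := Finset.mem_image.1 hx
      exact hw2 i (Finset.mem_range.1 hi)
    · rw [← Polynomial.count_roots, hroots]
      exact Multiset.count_eq_one_of_mem (Finset.nodup _) hx
  · intro x hx
    rw [← Finset.mem_val, ← hroots]
    exact (Polynomial.mem_roots hR0).2 hx
end
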